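/- Let f : ℝ^p → ℝ be differentiable with L-Lipschitz gradient, let S ⊆ {1, …, p} be a fixed subset of cardinality n_c ≥ 1, and let δ_j > 0 for j ∈ S. Then the subset coordinate finite-difference estimator g = (p/n_c)·Σ_{j∈S} ((f(x + δ_j·e_j) − f(x))/δ_j)·e_j satisfies ‖g − (p/n_c)·Σ_{j∈S} ∂_j f(x)·e_j‖ ≤ (p·L/(2·n_c))·(Σ_{j∈S} δ_j²)^{1/2}, where ‖·‖ is the Euclidean norm, e_j the j-th standard basis vector, and ∂_j f(x) the j-th partial derivative of f at x. -/

import Mathlib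

open Finset

open scoped RealInnerProductSpace in
/-- The quadratic Taylor bound for a function with `L`-Lipschitz gradient. -/
theorem abs_sub_sub_inner_gradient_le {F : Type*} [NormedAddCommGroup F] [InnerProductSpace ℝ F]
    [CompleteSpace F] {f : F → ℝ} {L : ℝ} (hf : Differentiable ℝ f)
    (hL : ∀ x y, ‖gradient f x - gradient f y‖ ≤ L * ‖x - y‖) (x v : F) :
    |f (x + v) - f x - ⟪gradient f x, v⟫| ≤ L / 2 * ‖v‖ ^ 2 := by
  have hderiv (t : ℝ) : HasDerivAt (fun t : ℝ => f (x + t • v) - f x - t * ⟪gradient f x, v⟫)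
      (⟪gradient f (x + t • v) - gradient f x, v⟫) t := by
    have hline : HasDerivAt (fun t : ℝ => x + t • v) v t := by
      simpa using ((hasDerivAt_id t).smul_const v).const_add x
    have hcomp := (hf (x + t • v)).hasGradientAt.hasFDerivAt.comp_hasDerivAt t hline
    have hlin := (hasDerivAt_id t).mul_const ⟪gradient f x, v⟫
    simpa [inner_sub_left] using! (hcomp.sub_const (f x)).sub hlin
  have hquad (t : ℝ) : HasDerivAt (fun t : ℝ => L / 2 * ‖v‖ ^ 2 * t ^ 2) (L * ‖v‖ ^ 2 * t) t :=
    ((hasDerivAt_pow 2 t).const_mul (L / 2 * ‖v‖ ^ 2)).congr_deriv (by push_cast; ring)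
  have hbound := image_norm_le_of_norm_deriv_right_le_deriv_boundary (a := 0) (b := 1)
    (fun t _ => (hderiv t).continuousAt.continuousWithinAt)
    (fun t _ => (hderiv t).hasDerivWithinAt) (by simp) hquad
    (fun t ht => calc
      ‖⟪gradient f (x + t • v) - gradient f x, v⟫‖
          ≤ ‖gradient f (x + t • v) - gradient f x‖ * ‖v‖ := norm_inner_le_norm _ _
      _ ≤ L * ‖x + t • v - x‖ * ‖v‖ := by gcongr; exact hL _ _
      _ = L * ‖v‖ ^ 2 * t := by
        rw [add_sub_cancel_left, norm_smul, Real.norm_of_nonneg ht.1]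
        ring)
    (Set.right_mem_Icc.2 zero_le_one)
  simpa using hbound

/-- The forward difference quotient along a coordinate approximates the partial derivative. -/
theorem abs_forward_difference_sub_gradient_le {ι : Type*} [Fintype ι] [DecidableEq ι]
    {f : EuclideanSpace ℝ ι → ℝ} {L : ℝ} (hf : Differentiable ℝ f)
    (hL : ∀ x y, ‖gradient f x - gradient f y‖ ≤ L * ‖x - y‖) (x : EuclideanSpace ℝ ι) (j : ι)
    {h : ℝ} (hh : 0 < h) :
    |(f (x + h • EuclideanSpace.single j (1 : ℝ)) - f x) / h - gradient f x j| ≤ L / 2 * h := by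
  have key := abs_sub_sub_inner_gradient_le hf hL x (h • EuclideanSpace.single j (1 : ℝ))
  simp only [inner_smul_right, EuclideanSpace.inner_single_right, norm_smul,
    PiLp.norm_single, norm_one, mul_one, Real.norm_of_nonneg hh.le, one_mul,
    conj_trivial] at key
  rw [div_sub' hh.ne', abs_div, abs_of_pos hh, div_le_iff₀ hh]
  linarith

/-- The Euclidean norm of a linear combination of standard basis vectors. -/
theorem EuclideanSpace.norm_sum_smul_single {ι : Type*} [Fintype ι] [DecidableEq ι]
    (S : Finset ι) (c : ι → ℝ) :
    ‖∑ j ∈ S, c j • EuclideanSpace.single j (1 : ℝ)‖ = √(∑ j ∈ S, c j ^ 2) := by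
  rw [norm_eq_sqrt_real_inner]
  have h := (EuclideanSpace.orthonormal_single (𝕜 := ℝ) (ι := ι)).inner_sum c c S
  simp only [h, conj_trivial, sq]

open Finset

/-- **Bias bound for the subset coordinate finite-difference estimator** (the ZOOM estimator of
equation (4) with a fixed coordinate subset `S` of cardinality `n_c`). The Euclidean distance
between the estimator and the correspondingly rescaled true coordinate gradient is at most
`(p·L/(2·n_c)) · (∑_{j∈S} δ_j²)^{1/2}`. -/
theorem subset_finite_difference_bias
    (p n_c : ℕ) (L : ℝ) (f : EuclideanSpace ℝ (Fin p) → ℝ)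
    (hdiff : Differentiable ℝ f)
    (hlip : ∀ x y : EuclideanSpace ℝ (Fin p), ‖gradient f x - gradient f y‖ ≤ L * ‖x - y‖)
    (S : Finset (Fin p)) (hScard : S.card = n_c) (hnc : 1 ≤ n_c)
    (δ : Fin p → ℝ) (hδ : ∀ j ∈ S, 0 < δ j)
    (x : EuclideanSpace ℝ (Fin p)) :
    ‖(((p : ℝ) / (n_c : ℝ)) •
          ∑ j ∈ S, ((f (x + δ j • EuclideanSpace.single j (1 : ℝ)) - f x) / δ j) •
            EuclideanSpace.single j (1 : ℝ)) -
        ((p : ℝ) / (n_c : ℝ)) •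
          ∑ j ∈ S, gradient f x j • EuclideanSpace.single j (1 : ℝ)‖ ≤
      ((p : ℝ) * L / (2 * (n_c : ℝ))) * Real.sqrt (∑ j ∈ S, (δ j) ^ 2) := by
  have hj (j) (hjS : j ∈ S) := abs_forward_difference_sub_gradient_le hdiff hlip x j (hδ j hjS)
  have hL : 0 ≤ L := by
    obtain ⟨j, hjS⟩ := Finset.card_pos.1 (by omega : 0 < S.card)
    nlinarith [(abs_nonneg _).trans (hj j hjS), hδ j hjS]
  rw [← smul_sub, ← Finset.sum_sub_distrib]
  simp only [← sub_smul]
  rw [norm_smul, Real.norm_of_nonneg (by positivity), EuclideanSpace.norm_sum_smul_single]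
  calc
    _ ≤ (p : ℝ) / n_c * √(∑ j ∈ S, (L / 2 * δ j) ^ 2) := by
      gcongr _ * √(∑ j ∈ S, ?_) with j hjS
      exact sq_le_sq' (abs_le.1 (hj j hjS)).1 (abs_le.1 (hj j hjS)).2
    _ = _ := by
      simp only [mul_pow, ← Finset.mul_sum]
      rw [Real.sqrt_mul (by positivity), Real.sqrt_sq (by positivity)]
      ring
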